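/- For every integer ℓ ≥ 1, the number of 6-tuples (α11, α12, α13, α22, α23, α33) of nonnegative integers satisfying the system T(2ℓ−2) equals (1/2)·ℓ·(1+ℓ²), the magic constant of a normal magic square of order ℓ. -/

import Mathlib

/-- The Diophantine system T(m): three equations in six nonnegative integer unknowns. -/
def Tsol (m : ℕ) : Set (ℕ × ℕ × ℕ × ℕ × ℕ × ℕ) :=
  {p | match p with
       | (a11, a12, a13, a22, a23, a33) =>
         2*a11 + a12 + a13 = m ∧
         a12 + 2*a22 + a23 = m ∧
         a13 + a23 + 2*a33 = m}

def Dset (k : ℕ) : Set (ℕ × ℕ) := {p | p.1 + p.2 < k}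

lemma Dset_card (k : ℕ) : (Dset k).Finite ∧ 2 * (Dset k).ncard = k * (k + 1) := by
  induction k with
  | zero =>
    have h : Dset 0 = ∅ := by ext p; simp [Dset]
    simp [h]
  | succ k ih =>
    obtain ⟨hf, hc⟩ := ih
    have h : Dset (k + 1) = (fun p : ℕ × ℕ => (p.1, p.2 + 1)) '' Dset k ∪
        (fun x : ℕ => (x, 0)) '' (Finset.range (k + 1) : Set ℕ) := by
      ext ⟨x, y⟩
      simp only [Dset, Set.mem_union, Set.mem_image, Set.mem_ofPred_eq, Prod.mk.injEq,
        Prod.exists, Finset.coe_range, Set.mem_Iio]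
      constructor
      · intro h
        rcases y with _ | y
        · exact Or.inr ⟨x, by omega, rfl, rfl⟩
        · exact Or.inl ⟨x, y, by omega, rfl, rfl⟩
      · rintro (⟨a, b, h1, h2, h3⟩ | ⟨a, h1, h2, h3⟩) <;> omega
    have f1 := hf.image (fun p : ℕ × ℕ => (p.1, p.2 + 1))
    have f2 := (Finset.range (k + 1)).finite_toSet.image (fun x : ℕ => (x, 0))
    refine ⟨h ▸ f1.union f2, ?_⟩
    rw [h, Set.ncard_union_eq _ f1 f2, Set.ncard_image_of_injective, Set.ncard_image_of_injective,
      Set.ncard_coe_finset, Finset.card_range]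
    · linarith
    · intro a b h; simpa using h
    · rintro ⟨a, b⟩ ⟨c, d⟩ h; simpa using h
    · rw [Set.disjoint_left]
      rintro ⟨x, y⟩ ⟨p, _, h1⟩ ⟨q, _, h2⟩
      simp only [Prod.mk.injEq] at h1 h2
      omega

def g0 (p : ℕ × ℕ × ℕ × ℕ × ℕ × ℕ) : ℕ × ℕ × ℕ × ℕ × ℕ × ℕ :=
  (p.1, p.2.1 + 1, p.2.2.1 + 1, p.2.2.2.1, p.2.2.2.2.1 + 1, p.2.2.2.2.2)
def g1 (n : ℕ) (p : ℕ × ℕ) : ℕ × ℕ × ℕ × ℕ × ℕ × ℕ :=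
  (n + 1 - p.1, 0, 2 * p.1, n + 1 - p.2, 2 * p.2, n + 1 - p.1 - p.2)
def g2 (n : ℕ) (p : ℕ × ℕ) : ℕ × ℕ × ℕ × ℕ × ℕ × ℕ :=
  (n - p.1, 2 * p.1 + 2, 0, n - p.1 - p.2, 2 * p.2, n + 1 - p.2)
def g3 (n : ℕ) (p : ℕ × ℕ) : ℕ × ℕ × ℕ × ℕ × ℕ × ℕ :=
  (n - 1 - p.1 - p.2, 2 * p.1 + 2, 2 * p.2 + 2, n - p.1, 0, n - p.2)

lemma Tsol_succ (n : ℕ) : Tsol (2 * (n + 1)) =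
    ((g0 '' Tsol (2 * n) ∪ g1 n '' Dset (n + 2)) ∪ g2 n '' Dset (n + 1)) ∪ g3 n '' Dset n := by
  ext ⟨a, x, y, b, z, c⟩
  simp only [Tsol, Dset, g0, g1, g2, g3, Set.mem_union, Set.mem_image, Set.mem_ofPred_eq,
    Prod.mk.injEq, Prod.exists]
  constructor
  · rintro ⟨h1, h2, h3⟩
    by_cases hx : x = 0
    · exact Or.inl (Or.inl (Or.inr ⟨y / 2, z / 2, by omega, by omega, by omega, by omega,
        by omega, by omega, by omega⟩))
    by_cases hy : y = 0
    · exact Or.inl (Or.inr ⟨x / 2 - 1, z / 2, by omega, by omega, by omega, by omega,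
        by omega, by omega, by omega⟩)
    by_cases hz : z = 0
    · exact Or.inr ⟨x / 2 - 1, y / 2 - 1, by omega, by omega, by omega, by omega,
        by omega, by omega, by omega⟩
    exact Or.inl (Or.inl (Or.inl ⟨a, x - 1, y - 1, b, z - 1, c, by omega, by omega, by omega,
      by omega, by omega, by omega, by omega⟩))
  · rintro (((⟨a', x', y', b', z', c', h⟩ | ⟨p, q, h⟩) | ⟨p, q, h⟩) | ⟨p, q, h⟩) <;>
      refine ⟨?_, ?_, ?_⟩ <;> omega

lemma Tsol_card (n : ℕ) : (Tsol (2 * n)).Finite ∧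
    2 * (Tsol (2 * n)).ncard = (n + 1) * (1 + (n + 1) ^ 2) := by
  induction n with
  | zero =>
    have h : Tsol (2 * 0) = {(0, 0, 0, 0, 0, 0)} := by
      ext ⟨a, x, y, b, z, c⟩
      simp only [Tsol, Set.mem_ofPred_eq, Set.mem_singleton_iff, Prod.mk.injEq]
      omega
    rw [h]; simp
  | succ n ih =>
    obtain ⟨hf, hc⟩ := ih
    obtain ⟨d1, e1⟩ := Dset_card (n + 2)
    obtain ⟨d2, e2⟩ := Dset_card (n + 1)
    obtain ⟨d3, e3⟩ := Dset_card n
    have f0 := hf.image g0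
    have f1 := d1.image (g1 n)
    have f2 := d2.image (g2 n)
    have f3 := d3.image (g3 n)
    rw [Tsol_succ]
    refine ⟨((f0.union f1).union f2).union f3, ?_⟩
    rw [Set.ncard_union_eq _ ((f0.union f1).union f2) f3, Set.ncard_union_eq _ (f0.union f1) f2,
      Set.ncard_union_eq _ f0 f1, Set.ncard_image_of_injective, Set.ncard_image_of_injective,
      Set.ncard_image_of_injective, Set.ncard_image_of_injective]
    · nlinarith
    · rintro ⟨a, b⟩ ⟨c, d⟩ h
      simp only [g3, Prod.mk.injEq] at h ⊢
      omega
    · rintro ⟨a, b⟩ ⟨c, d⟩ h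
      simp only [g2, Prod.mk.injEq] at h ⊢
      omega
    · rintro ⟨a, b⟩ ⟨c, d⟩ h
      simp only [g1, Prod.mk.injEq] at h ⊢
      omega
    · rintro ⟨a, x, y, b, z, c⟩ ⟨a', x', y', b', z', c'⟩ h
      simp only [g0, Prod.mk.injEq] at h ⊢
      omega
    all_goals
      rw [Set.disjoint_left]
      rintro ⟨a, x, y, b, z, c⟩ h1 h2
      simp only [g0, g1, g2, g3, Set.mem_union, Set.mem_image, Prod.mk.injEq, Prod.exists] at h1 h2
    · obtain ⟨_, _, _, _, _, _, h1⟩ := h1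
      obtain ⟨_, _, h2⟩ := h2
      omega
    · obtain ⟨_, _, h2⟩ := h2
      rcases h1 with ⟨_, _, _, _, _, _, h1⟩ | ⟨_, _, h1⟩ <;> omega
    · obtain ⟨_, _, h2⟩ := h2
      rcases h1 with (⟨_, _, _, _, _, _, h1⟩ | ⟨_, _, h1⟩) | ⟨_, _, h1⟩ <;> omega

theorem number_of_solutions_magic (ℓ : ℕ) (hℓ : 1 ≤ ℓ) :
    ((Tsol (2*ℓ - 2)).ncard : ℚ) = (1/2) * (ℓ : ℚ) * (1 + (ℓ : ℚ)^2) := by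
  obtain ⟨n, rfl⟩ : ∃ n, ℓ = n + 1 := ⟨ℓ - 1, by omega⟩
  have h := (Tsol_card n).2
  have e : 2 * (n + 1) - 2 = 2 * n := by omega
  rw [e]
  have h' : (2 : ℚ) * ((Tsol (2 * n)).ncard : ℚ) = (n + 1) * (1 + (n + 1) ^ 2) := by
    exact_mod_cast h
  push_cast
  linarith
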